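/- Consider terms over variables v₁, …, vₙ built from the operations ∪, ∩ and complement, interpreted over subsets of ℕ as follows: for an assignment a : {1,…,n} → ℕ, ⟦vᵢ⟧_a = {a(i)}, ⟦s ∪ t⟧_a = ⟦s⟧_a ∪ ⟦t⟧_a, ⟦s ∩ t⟧_a = ⟦s⟧_a ∩ ⟦t⟧_a, and ⟦t̄⟧_a = ℕ ∖ ⟦t⟧_a. Then for every term t, the following are equivalent: (1) there exists an assignment a : {1,…,n} → ℕ with ⟦t⟧_a ∩ {1} = {1}; (2) there exists an assignment a : {1,…,n} → {0,1} with 1 ∈ ⟦t⟧_a. -/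

import Mathlib

/-- Terms over variables `v₁, …, vₙ` built from `∪`, `∩` and complement. -/
inductive BTerm (n : ℕ) : Type where
  | var : Fin n → BTerm n
  | union : BTerm n → BTerm n → BTerm n
  | inter : BTerm n → BTerm n → BTerm n
  | compl : BTerm n → BTerm n

/-- Interpretation of a term under an assignment `a : Fin n → ℕ`. -/
def BTerm.eval {n : ℕ} (a : Fin n → ℕ) : BTerm n → Set ℕ
  | .var i => {a i}
  | .union s t => BTerm.eval a s ∪ BTerm.eval a t
  | .inter s t => BTerm.eval a s ∩ BTerm.eval a t
  | .compl t => (BTerm.eval a t)ᶜ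

/-- Membership of a point in the value of a term depends only on which variables
are assigned that point. -/
theorem BTerm.mem_eval_congr {n : ℕ} {a b : Fin n → ℕ} {k : ℕ}
    (h : ∀ i, a i = k ↔ b i = k) (t : BTerm n) :
    k ∈ BTerm.eval a t ↔ k ∈ BTerm.eval b t := by
  induction t with
  | var i => simpa [BTerm.eval, eq_comm] using h i
  | union s t hs ht => simp [BTerm.eval, hs, ht]
  | inter s t hs ht => simp [BTerm.eval, hs, ht]
  | compl t ht => simp [BTerm.eval, ht]

/-- for every term `t`, there is an assignment over ℕ with
`⟦t⟧_a ∩ {1} = {1}` iff there is a `{0,1}`-valued assignment with `1 ∈ ⟦t⟧_a`. -/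
theorem statement12 (n : ℕ) (t : BTerm n) :
    (∃ a : Fin n → ℕ, BTerm.eval a t ∩ {1} = {1}) ↔
    (∃ a : Fin n → ℕ, (∀ i : Fin n, a i = 0 ∨ a i = 1) ∧ 1 ∈ BTerm.eval a t) := by
  simp only [Set.inter_eq_right, Set.singleton_subset_iff]
  constructor
  · rintro ⟨a, ha⟩
    refine ⟨fun i => if a i = 1 then 1 else 0, fun i => ?_, ?_⟩
    · by_cases hi : a i = 1 <;> simp [hi]
    · exact (BTerm.mem_eval_congr (fun i => by simp) t).mp ha
  · rintro ⟨a, -, ha⟩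
    exact ⟨a, ha⟩
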